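/- arXiv:1912.06562 — 14 statements merged into one kernel-verified Lean document; each statement's English description precedes it below -/
import Mathlib

section
/- (Magnetic bound-state metamorphosis.) Let n, ℓ, m be integers and let γ = ((p, q), (r, s)) be an integer matrix with determinant 1 such that m_γ = −1. Define the metamorphic dual γ̃ = γ · ((1, −ℓ_γ), (0, 1)). Then m_{γ̃} = −1, n_{γ̃} = n_γ, and ℓ_{γ̃} = −ℓ_γ; in particular (−1)^{ℓ_{γ̃}+1}·|ℓ_{γ̃}| = (−1)^{ℓ_γ+1}·|ℓ_γ|, so γ and γ̃ have the same index contribution (−1)^{ℓ_γ+1}·|ℓ_γ|·d(m_γ)·d(n_γ) for any function d. -/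
/-- Magnetic bound-state metamorphosis: if `γ = ((p,q),(r,s)) ∈ SL(2,ℤ)` has
`m_γ = -1`, then the metamorphic dual `γ̃ = γ·((1,-ℓ_γ),(0,1)) = ((p, q - p·ℓ_γ),(r, s - r·ℓ_γ))`
satisfies `m_γ̃ = -1`, `n_γ̃ = n_γ`, `ℓ_γ̃ = -ℓ_γ`; in particular
`(-1)^(ℓ_γ̃+1)·|ℓ_γ̃| = (-1)^(ℓ_γ+1)·|ℓ_γ|`, so `γ` and `γ̃` have the same index
contribution `(-1)^(ℓ_γ+1)·|ℓ_γ|·d(m_γ)·d(n_γ)` for any function `d`. -/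
theorem magnetic_metamorphosis (n ℓ m p q r s : ℤ) (hdet : p * s - q * r = 1)
    (nγ ℓγ mγ : ℤ)
    (hn : nγ = s ^ 2 * n + q ^ 2 * m - s * q * ℓ)
    (hl : ℓγ = -2 * s * r * n - 2 * p * q * m + ℓ * (p * s + q * r))
    (hm : mγ = r ^ 2 * n + p ^ 2 * m - p * r * ℓ)
    (hmeta : mγ = -1)
    (p' q' r' s' : ℤ)
    (hp' : p' = p) (hq' : q' = q - p * ℓγ) (hr' : r' = r) (hs' : s' = s - r * ℓγ)
    (d : ℤ → ℤ) :
    r' ^ 2 * n + p' ^ 2 * m - p' * r' * ℓ = -1 ∧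
    s' ^ 2 * n + q' ^ 2 * m - s' * q' * ℓ = nγ ∧
    -2 * s' * r' * n - 2 * p' * q' * m + ℓ * (p' * s' + q' * r') = -ℓγ ∧
    ((-ℓγ + 1).negOnePow : ℤ) * |(-ℓγ)| = ((ℓγ + 1).negOnePow : ℤ) * |ℓγ| ∧
    ((-2 * s' * r' * n - 2 * p' * q' * m + ℓ * (p' * s' + q' * r') + 1).negOnePow : ℤ)
        * |(-2 * s' * r' * n - 2 * p' * q' * m + ℓ * (p' * s' + q' * r'))|
        * d (r' ^ 2 * n + p' ^ 2 * m - p' * r' * ℓ)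
        * d (s' ^ 2 * n + q' ^ 2 * m - s' * q' * ℓ)
      = ((ℓγ + 1).negOnePow : ℤ) * |ℓγ| * d mγ * d nγ := by
  have h1 : r' ^ 2 * n + p' ^ 2 * m - p' * r' * ℓ = -1 := by
    rw [hp', hr', ← hm, hmeta]
  have h2 : s' ^ 2 * n + q' ^ 2 * m - s' * q' * ℓ = nγ := by
    rw [hs', hq']
    linear_combination (-1) * hn - ℓγ * hl - ℓγ ^ 2 * hm + ℓγ ^ 2 * hmeta
  have h3 : -2 * s' * r' * n - 2 * p' * q' * m + ℓ * (p' * s' + q' * r') = -ℓγ := by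
    rw [hs', hq', hp', hr']
    linear_combination (-1) * hl - 2 * ℓγ * hm + 2 * ℓγ * hmeta
  have h4 : ((-ℓγ + 1).negOnePow : ℤ) * |(-ℓγ)| = ((ℓγ + 1).negOnePow : ℤ) * |ℓγ| := by
    rw [abs_neg, Int.negOnePow_add, Int.negOnePow_add, Int.negOnePow_neg]
  refine ⟨h1, h2, h3, h4, ?_⟩
  rw [h1, h2, h3, h4, hmeta]
end

section
/- (Electric bound-state metamorphosis.) Let n, ℓ, m be integers and let γ = ((p, q), (r, s)) be an integer matrix with determinant 1 such that n_γ = −1. Define the metamorphic dual γ̃ = γ · ((1, 0), (−ℓ_γ, 1)). Then n_{γ̃} = −1, m_{γ̃} = m_γ, and ℓ_{γ̃} = −ℓ_γ; in particular γ and γ̃ have the same index contribution (−1)^{ℓ_γ+1}·|ℓ_γ|·d(m_γ)·d(n_γ) for any function d. -/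
/-- Electric bound-state metamorphosis: if `γ = ((p,q),(r,s)) ∈ SL(2,ℤ)` has
`n_γ = -1`, then the metamorphic dual `γ̃ = γ·((1,0),(-ℓ_γ,1)) = ((p - q·ℓ_γ, q),(r - s·ℓ_γ, s))`
satisfies `n_γ̃ = -1`, `m_γ̃ = m_γ`, `ℓ_γ̃ = -ℓ_γ`; in particular `γ` and `γ̃` have the
same index contribution `(-1)^(ℓ_γ+1)·|ℓ_γ|·d(m_γ)·d(n_γ)` for any function `d`. -/
theorem electric_metamorphosis (n ℓ m p q r s : ℤ) (hdet : p * s - q * r = 1)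
    (nγ ℓγ mγ : ℤ)
    (hn : nγ = s ^ 2 * n + q ^ 2 * m - s * q * ℓ)
    (hl : ℓγ = -2 * s * r * n - 2 * p * q * m + ℓ * (p * s + q * r))
    (hm : mγ = r ^ 2 * n + p ^ 2 * m - p * r * ℓ)
    (hmeta : nγ = -1)
    (p' q' r' s' : ℤ)
    (hp' : p' = p - q * ℓγ) (hq' : q' = q) (hr' : r' = r - s * ℓγ) (hs' : s' = s)
    (d : ℤ → ℤ) :
    s' ^ 2 * n + q' ^ 2 * m - s' * q' * ℓ = -1 ∧
    r' ^ 2 * n + p' ^ 2 * m - p' * r' * ℓ = mγ ∧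
    -2 * s' * r' * n - 2 * p' * q' * m + ℓ * (p' * s' + q' * r') = -ℓγ ∧
    ((-2 * s' * r' * n - 2 * p' * q' * m + ℓ * (p' * s' + q' * r') + 1).negOnePow : ℤ)
        * |(-2 * s' * r' * n - 2 * p' * q' * m + ℓ * (p' * s' + q' * r'))|
        * d (r' ^ 2 * n + p' ^ 2 * m - p' * r' * ℓ)
        * d (s' ^ 2 * n + q' ^ 2 * m - s' * q' * ℓ)
      = ((ℓγ + 1).negOnePow : ℤ) * |ℓγ| * d mγ * d nγ := by
  subst hp' hq' hr' hs'
  have h1 : s' ^ 2 * n + q' ^ 2 * m - s' * q' * ℓ = -1 := by rw [← hn, hmeta]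
  have h2 : (r - s' * ℓγ) ^ 2 * n + (p - q' * ℓγ) ^ 2 * m
      - (p - q' * ℓγ) * (r - s' * ℓγ) * ℓ = mγ := by
    linear_combination -hm - ℓγ * hl + ℓγ ^ 2 * h1
  have h3 : -2 * s' * (r - s' * ℓγ) * n - 2 * (p - q' * ℓγ) * q' * m
      + ℓ * ((p - q' * ℓγ) * s' + q' * (r - s' * ℓγ)) = -ℓγ := by
    linear_combination -hl + 2 * ℓγ * h1
  refine ⟨h1, h2, h3, ?_⟩
  rw [h1, h2, h3, hmeta, abs_neg, Int.negOnePow_add, Int.negOnePow_add, Int.negOnePow_neg]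
end

section
/- (Dyonic bound-state metamorphosis orbit.) Let n, ℓ, m be integers and let γ be an integer matrix with determinant 1 such that m_γ = n_γ = −1. Write L = ℓ_γ, M₁ = ((1, −L), (0, 1)) and M₀ = ((1, 0), (L, 1)), and define the sequence of metamorphic duals γ̃₀ = γ and γ̃ᵢ = γ̃_{i−1}·M_{(i mod 2)} for i ≥ 1 (so γ̃₁ = γ·M₁, γ̃₂ = γ̃₁·M₀, γ̃₃ = γ̃₂·M₁, …). Then for every i ≥ 0 one has m_{γ̃ᵢ} = −1, n_{γ̃ᵢ} = −1, and ℓ_{γ̃ᵢ} = (−1)^i · L; in particular all duals γ̃ᵢ have the same index contribution (−1)^{ℓ_γ+1}·|ℓ_γ|·d(m_γ)·d(n_γ) as γ for any function d. -/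
/-- Transformed charge invariant `n_γ = s²n + q²m - sqℓ` for `γ = ((p,q),(r,s))`. -/
def nInv (n ℓ m : ℤ) (γ : Matrix (Fin 2) (Fin 2) ℤ) : ℤ :=
  (γ 1 1) ^ 2 * n + (γ 0 1) ^ 2 * m - (γ 1 1) * (γ 0 1) * ℓ

/-- Transformed charge invariant `ℓ_γ = -2srn - 2pqm + ℓ(ps+qr)` for `γ = ((p,q),(r,s))`. -/
def lInv (n ℓ m : ℤ) (γ : Matrix (Fin 2) (Fin 2) ℤ) : ℤ :=
  -2 * (γ 1 1) * (γ 1 0) * n - 2 * (γ 0 0) * (γ 0 1) * m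
    + ℓ * ((γ 0 0) * (γ 1 1) + (γ 0 1) * (γ 1 0))

/-- Transformed charge invariant `m_γ = r²n + p²m - prℓ` for `γ = ((p,q),(r,s))`. -/
def mInv (n ℓ m : ℤ) (γ : Matrix (Fin 2) (Fin 2) ℤ) : ℤ :=
  (γ 1 0) ^ 2 * n + (γ 0 0) ^ 2 * m - (γ 0 0) * (γ 1 0) * ℓ

/-- The sequence of dyonic metamorphic duals: `γ̃₀ = γ`,
`γ̃ᵢ = γ̃_{i-1}·M_{(i mod 2)}` with `M₁ = ((1,-L),(0,1))`, `M₀ = ((1,0),(L,1))`. -/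
def dualSeq (L : ℤ) (γ : Matrix (Fin 2) (Fin 2) ℤ) : ℕ → Matrix (Fin 2) (Fin 2) ℤ
  | 0 => γ
  | i + 1 => dualSeq L γ i * (if (i + 1) % 2 = 1 then !![1, -L; 0, 1] else !![1, 0; L, 1])

theorem mInv_upper (n ℓ m L : ℤ) (g : Matrix (Fin 2) (Fin 2) ℤ) :
    mInv n ℓ m (g * !![1, -L; 0, 1]) = mInv n ℓ m g := by
  simp [mInv, Matrix.mul_apply, Fin.sum_univ_two]

theorem nInv_upper (n ℓ m L : ℤ) (g : Matrix (Fin 2) (Fin 2) ℤ) :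
    nInv n ℓ m (g * !![1, -L; 0, 1])
      = nInv n ℓ m g + L ^ 2 * mInv n ℓ m g + L * lInv n ℓ m g := by
  simp [mInv, nInv, lInv, Matrix.mul_apply, Fin.sum_univ_two]
  ring

theorem lInv_upper (n ℓ m L : ℤ) (g : Matrix (Fin 2) (Fin 2) ℤ) :
    lInv n ℓ m (g * !![1, -L; 0, 1]) = lInv n ℓ m g + 2 * L * mInv n ℓ m g := by
  simp [mInv, lInv, Matrix.mul_apply, Fin.sum_univ_two]
  ring

theorem nInv_lower (n ℓ m L : ℤ) (g : Matrix (Fin 2) (Fin 2) ℤ) :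
    nInv n ℓ m (g * !![1, 0; L, 1]) = nInv n ℓ m g := by
  simp [nInv, Matrix.mul_apply, Fin.sum_univ_two]

theorem mInv_lower (n ℓ m L : ℤ) (g : Matrix (Fin 2) (Fin 2) ℤ) :
    mInv n ℓ m (g * !![1, 0; L, 1])
      = mInv n ℓ m g + L ^ 2 * nInv n ℓ m g - L * lInv n ℓ m g := by
  simp [mInv, nInv, lInv, Matrix.mul_apply, Fin.sum_univ_two]
  ring

theorem lInv_lower (n ℓ m L : ℤ) (g : Matrix (Fin 2) (Fin 2) ℤ) :
    lInv n ℓ m (g * !![1, 0; L, 1]) = lInv n ℓ m g - 2 * L * nInv n ℓ m g := by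
  simp [nInv, lInv, Matrix.mul_apply, Fin.sum_univ_two]
  ring

/-- Dyonic bound-state metamorphosis orbit: if `γ ∈ SL(2,ℤ)` satisfies
`m_γ = n_γ = -1` and `L = ℓ_γ`, then every metamorphic dual `γ̃ᵢ` has
`m_{γ̃ᵢ} = -1`, `n_{γ̃ᵢ} = -1`, `ℓ_{γ̃ᵢ} = (-1)^i·L`; in particular all duals have the
same index contribution `(-1)^(ℓ_γ+1)·|ℓ_γ|·d(m_γ)·d(n_γ)` as `γ`, for any function `d`. -/
theorem dyonic_metamorphosis_orbit (n ℓ m : ℤ) (γ : Matrix (Fin 2) (Fin 2) ℤ)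
    (hdet : γ.det = 1) (hm : mInv n ℓ m γ = -1) (hn : nInv n ℓ m γ = -1)
    (L : ℤ) (hL : L = lInv n ℓ m γ) (d : ℤ → ℤ) :
    ∀ i : ℕ,
      mInv n ℓ m (dualSeq L γ i) = -1 ∧
      nInv n ℓ m (dualSeq L γ i) = -1 ∧
      lInv n ℓ m (dualSeq L γ i) = (-1) ^ i * L ∧
      ((lInv n ℓ m (dualSeq L γ i) + 1).negOnePow : ℤ)
          * |lInv n ℓ m (dualSeq L γ i)|
          * d (mInv n ℓ m (dualSeq L γ i)) * d (nInv n ℓ m (dualSeq L γ i))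
        = ((lInv n ℓ m γ + 1).negOnePow : ℤ) * |lInv n ℓ m γ|
            * d (mInv n ℓ m γ) * d (nInv n ℓ m γ) := by
  have key : ∀ i : ℕ, mInv n ℓ m (dualSeq L γ i) = -1 ∧ nInv n ℓ m (dualSeq L γ i) = -1 ∧
      lInv n ℓ m (dualSeq L γ i) = (-1) ^ i * L := by
    intro i
    induction i with
    | zero => exact ⟨hm, hn, by simp [dualSeq, hL]⟩
    | succ i ih =>
      obtain ⟨h1, h2, h3⟩ := ih
      rcases Nat.even_or_odd i with he | ho
      · have hc : (i + 1) % 2 = 1 := by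
          obtain ⟨k, rfl⟩ := he
          omega
        rw [he.neg_one_pow] at h3
        rw [dualSeq, if_pos hc, mInv_upper, nInv_upper, lInv_upper, h1, h2, h3, pow_succ (-1) i,
          he.neg_one_pow]
        refine ⟨rfl, ?_, ?_⟩ <;> ring
      · have hc : ¬ (i + 1) % 2 = 1 := by
          obtain ⟨k, rfl⟩ := ho
          omega
        rw [ho.neg_one_pow] at h3
        rw [dualSeq, if_neg hc, mInv_lower, nInv_lower, lInv_lower, h1, h2, h3, pow_succ (-1) i,
          ho.neg_one_pow]
        refine ⟨?_, rfl, ?_⟩ <;> ring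
  intro i
  obtain ⟨h1, h2, h3⟩ := key i
  refine ⟨h1, h2, h3, ?_⟩
  rw [h1, h2, h3, hm, hn, ← hL]
  rcases Nat.even_or_odd i with he | ho
  · rw [he.neg_one_pow, one_mul]
  · rw [ho.neg_one_pow, neg_one_mul, abs_neg, Int.negOnePow_add, Int.negOnePow_add,
      Int.negOnePow_neg]
end

section
/- Let m ≥ 1 and ℓ be integers with 0 ≤ ℓ ≤ m, and set n = −1. Then there is no integer matrix γ = ((p, q), (r, s)) with determinant 1, r > 0 and s > 0, satisfying simultaneously n_γ ≥ 0, m_γ ≥ 0 and ℓ_γ > 0. (No wall without metamorphosis contributes to the polar degeneracies when n = −1.) -/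
/-- For charges `(n,ℓ,m) = (-1,ℓ,m)` with `m ≥ 1` and `0 ≤ ℓ ≤ m`, there is no
`γ = ((p,q),(r,s)) ∈ SL(2,ℤ)` with `r > 0`, `s > 0` satisfying simultaneously
`n_γ ≥ 0`, `m_γ ≥ 0` and `ℓ_γ > 0`: no wall without metamorphosis contributes
to the polar degeneracies when `n = -1`. -/
theorem no_wall_n_eq_neg_one (m ℓ : ℤ) (hm : 1 ≤ m) (hl0 : 0 ≤ ℓ) (hlm : ℓ ≤ m) :
    ¬ ∃ p q r s : ℤ,
      p * s - q * r = 1 ∧ 0 < r ∧ 0 < s ∧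
      0 ≤ s ^ 2 * (-1) + q ^ 2 * m - s * q * ℓ ∧
      0 ≤ r ^ 2 * (-1) + p ^ 2 * m - p * r * ℓ ∧
      0 < -2 * s * r * (-1) - 2 * p * q * m + ℓ * (p * s + q * r) := by
  rintro ⟨p, q, r, s, hdet, hr, hs, hn, hmm, hl⟩
  obtain ⟨A, hA⟩ : ∃ A, A = q * m - s * ℓ := ⟨_, rfl⟩
  obtain ⟨B, hB⟩ : ∃ B, B = p * m - r * ℓ := ⟨_, rfl⟩
  have h1 : s ^ 2 ≤ q * A := by rw [hA]; linarith
  have h2 : r ^ 2 ≤ p * B := by rw [hB]; linarith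
  have h3 : p * A + q * B < 2 * (s * r) := by rw [hA, hB]; linarith
  have hs2 : 0 < s ^ 2 := by positivity
  have hr2 : 0 < r ^ 2 := by positivity
  have hqA : 0 < q * A := by linarith
  have hpB : 0 < p * B := by linarith
  have key : 0 < p * A → 0 < q * B → False := by
    intro ha hb
    have h4 : s ^ 2 * r ^ 2 ≤ (q * A) * (p * B) := by gcongr
    have h5 : (p * A + q * B) ^ 2 < (2 * (s * r)) ^ 2 := by gcongr
    linarith [sq_nonneg (p * A - q * B)]
  rcases pos_and_pos_or_neg_and_neg_of_mul_pos hqA with ⟨hq, hA0⟩ | ⟨hq, hA0⟩ <;>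
    rcases pos_and_pos_or_neg_and_neg_of_mul_pos hpB with ⟨hp, hB0⟩ | ⟨hp, hB0⟩
  · exact key (mul_pos hp hA0) (mul_pos hq hB0)
  · nlinarith [mul_pos hq hr, mul_pos (neg_pos.2 hp) hs]
  · nlinarith [mul_le_mul_of_nonneg_right (show (1 : ℤ) ≤ p from hp) hs.le,
      mul_le_mul_of_nonneg_right (show (1 : ℤ) ≤ -q by lia) hr.le]
  · exact key (mul_pos_of_neg_of_neg hp hA0) (mul_pos_of_neg_of_neg hq hB0)
end

section
/- Let m ≥ 1 and ℓ ≥ 1 be integers with ℓ ≤ m, and set n = 0. Then an integer matrix γ = ((p, q), (r, s)) with determinant 1, r > 0 and s > 0 satisfies n_γ ≥ 0, m_γ ≥ 0 and ℓ_γ > 0 if and only if q = 0, p = s = 1, and 1 ≤ r with r·ℓ ≤ m; i.e. the contributing walls without metamorphosis are exactly the matrices ((1, 0), (r, 1)) with 0 < r ≤ m/ℓ. -/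
/-- For charges `(n,ℓ,m) = (0,ℓ,m)` with `m ≥ 1` and `1 ≤ ℓ ≤ m`, a matrix
`γ = ((p,q),(r,s)) ∈ SL(2,ℤ)` with `r > 0`, `s > 0` satisfies `n_γ ≥ 0`, `m_γ ≥ 0`
and `ℓ_γ > 0` if and only if `q = 0`, `p = s = 1`, `1 ≤ r` and `r·ℓ ≤ m`:
the contributing walls without metamorphosis are exactly `((1,0),(r,1))`
with `0 < r ≤ m/ℓ`. -/
theorem walls_n_eq_zero (m ℓ : ℤ) (hm : 1 ≤ m) (hl1 : 1 ≤ ℓ) (hlm : ℓ ≤ m)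
    (p q r s : ℤ) (hdet : p * s - q * r = 1) (hr : 0 < r) (hs : 0 < s) :
    (0 ≤ s ^ 2 * 0 + q ^ 2 * m - s * q * ℓ ∧
     0 ≤ r ^ 2 * 0 + p ^ 2 * m - p * r * ℓ ∧
     0 < -2 * s * r * 0 - 2 * p * q * m + ℓ * (p * s + q * r)) ↔
    (q = 0 ∧ p = 1 ∧ s = 1 ∧ 1 ≤ r ∧ r * ℓ ≤ m) := by
  constructor
  · rintro ⟨h1, h2, h3⟩
    rcases lt_trichotomy q 0 with hq | hq | hq
    · exfalso
      have hqr : q * r < 0 := mul_neg_of_neg_of_pos hq hr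
      have hps : p * s ≤ 0 := by linarith
      have hp : p ≤ 0 := by
        by_contra hc
        have := mul_pos (not_le.mp hc) hs
        linarith
      have hpq : 0 ≤ p * q := mul_nonneg_of_nonpos_of_nonpos hp hq.le
      have h4 : 0 ≤ p * q * m := mul_nonneg hpq (by linarith)
      have h5 : ℓ * (p * s + q * r) < 0 :=
        mul_neg_of_pos_of_neg (by linarith) (by linarith)
      linarith
    · subst hq
      have hps : p * s = 1 := by linarith
      have hs1 : s = 1 := by
        rcases Int.mul_eq_one_iff_eq_one_or_neg_one.mp hps with h | h
        · exact h.2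
        · omega
      subst hs1
      have hp1 : p = 1 := by linarith
      subst hp1
      exact ⟨rfl, rfl, rfl, by omega, by linarith⟩
    · exfalso
      have hqr : 0 < q * r := mul_pos hq hr
      have hp : 0 < p := by
        by_contra hc
        have := mul_nonpos_of_nonpos_of_nonneg (not_lt.mp hc) hs.le
        linarith
      have h4 : 0 ≤ q * m - s * ℓ := by
        refine nonneg_of_mul_nonneg_right (a := q) ?_ hq
        linarith
      have h5 : 0 ≤ p * m - r * ℓ := by
        refine nonneg_of_mul_nonneg_right (a := p) ?_ hp
        linarith
      have h6 := mul_nonneg hp.le h4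
      have h7 := mul_nonneg hq.le h5
      linarith
  · rintro ⟨rfl, rfl, rfl, h1, h2⟩
    refine ⟨by linarith, by linarith, by linarith⟩
end

section
/- Let m, n, ℓ be integers with m ≥ 1, n ≥ 1, 1 ≤ ℓ ≤ m and ℓ² > 4·m·n, and write |Δ| = ℓ² − 4·m·n. For the matrix γ = ((1, 0), (r, 1)) with integer r ≥ 1, the conditions n_γ ≥ 0, m_γ ≥ 0 and ℓ_γ > 0 hold if and only if 2·n·r ≤ ℓ − √(ℓ² − 4·m·n) (as real numbers); moreover in this case r ≤ (m − 1)/(2n). -/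
/-- For charges `(n,ℓ,m)` with `m,n ≥ 1`, `1 ≤ ℓ ≤ m` and `ℓ² > 4mn`, and the wall
`γ = ((1,0),(r,1))` with `r ≥ 1`: the conditions `n_γ ≥ 0`, `m_γ ≥ 0`, `ℓ_γ > 0`
hold if and only if `2nr ≤ ℓ - √(ℓ² - 4mn)` (as real numbers); moreover in that
case `r ≤ (m-1)/(2n)`. -/
theorem walls_case3a (m n ℓ r : ℤ) (hm : 1 ≤ m) (hn : 1 ≤ n)
    (hl1 : 1 ≤ ℓ) (hlm : ℓ ≤ m) (hD : 4 * m * n < ℓ ^ 2) (hr : 1 ≤ r) :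
    ((0 ≤ 1 ^ 2 * n + 0 ^ 2 * m - 1 * 0 * ℓ ∧
      0 ≤ r ^ 2 * n + 1 ^ 2 * m - 1 * r * ℓ ∧
      0 < -2 * 1 * r * n - 2 * 1 * 0 * m + ℓ * (1 * 1 + 0 * r)) ↔
     (2 * n * r : ℝ) ≤ (ℓ : ℝ) - Real.sqrt ((ℓ : ℝ) ^ 2 - 4 * m * n)) ∧
    ((2 * n * r : ℝ) ≤ (ℓ : ℝ) - Real.sqrt ((ℓ : ℝ) ^ 2 - 4 * m * n) →
      (r : ℝ) ≤ ((m : ℝ) - 1) / (2 * n)) := by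
  have hDR : (0 : ℝ) < (ℓ : ℝ) ^ 2 - 4 * m * n := by
    have : (4 * m * n : ℝ) < (ℓ : ℝ) ^ 2 := by exact_mod_cast hD
    linarith
  have hs := Real.sqrt_pos.mpr hDR
  have hlt : (2 * n * r : ℝ) ≤ (ℓ : ℝ) - Real.sqrt ((ℓ : ℝ) ^ 2 - 4 * m * n) →
      2 * n * r < ℓ := by
    intro h
    have : (2 * n * r : ℝ) < ℓ := by linarith
    exact_mod_cast this
  refine ⟨⟨?_, ?_⟩, ?_⟩
  · rintro ⟨-, h2, h3⟩
    have h4 : 0 ≤ ℓ - 2 * n * r := by linarith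
    have h5 : ℓ ^ 2 - 4 * m * n ≤ (ℓ - 2 * n * r) ^ 2 := by
      have := mul_nonneg (show (0 : ℤ) ≤ 4 * n by linarith) h2
      linarith
    have h4' : (0 : ℝ) ≤ (ℓ : ℝ) - 2 * n * r := by exact_mod_cast h4
    have h5' : (ℓ : ℝ) ^ 2 - 4 * m * n ≤ ((ℓ : ℝ) - 2 * n * r) ^ 2 := by exact_mod_cast h5
    have := (Real.sqrt_le_left h4').mpr h5'
    linarith
  · intro h
    have h3 := hlt h
    have h6 : Real.sqrt ((ℓ : ℝ) ^ 2 - 4 * m * n) ≤ (ℓ : ℝ) - 2 * n * r := by linarith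
    have h5' := (Real.sqrt_le_left (hs.le.trans h6)).mp h6
    have h5 : ℓ ^ 2 - 4 * m * n ≤ (ℓ - 2 * n * r) ^ 2 := by exact_mod_cast h5'
    refine ⟨by linarith, ?_, by linarith⟩
    have h7 : 0 ≤ (4 * n) * (r ^ 2 * n + 1 ^ 2 * m - 1 * r * ℓ) := by linarith
    exact nonneg_of_mul_nonneg_right h7 (by linarith)
  · intro h
    have h3 := hlt h
    have hnR : (0 : ℝ) < 2 * n := by
      have : (1 : ℝ) ≤ n := by exact_mod_cast hn
      linarith
    rw [le_div_iff₀ hnR]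
    have h8 : r * (2 * n) ≤ m - 1 := by linarith
    exact_mod_cast h8
end

section
/- Let m, n, ℓ be integers with m ≥ 1, n ≥ 1, 1 ≤ ℓ ≤ m and ℓ² > 4·m·n, and write √|Δ| = √(ℓ² − 4·m·n) (a positive real number). Suppose γ = ((p, q), (r, s)) is an integer matrix with determinant 1, r > 0, s > 0, p·s > 1, and n_γ ≥ 0, m_γ ≥ 0, ℓ_γ > 0. Then the following bounds hold: 2·√|Δ|·(p·s) ≤ ℓ + √|Δ|; (ℓ + √|Δ|)·(p·s − 1) ≤ 2·n·(r·s) ≤ (ℓ − √|Δ|)·(p·s); and r·s ≤ m/√|Δ|. In particular p·s ≤ (m+1)/2. -/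
/-- For charges `(n,ℓ,m)` with `m,n ≥ 1`, `1 ≤ ℓ ≤ m`, `ℓ² > 4mn`, write
`√|Δ| = √(ℓ² - 4mn)`. If `γ = ((p,q),(r,s)) ∈ SL(2,ℤ)` has `r > 0`, `s > 0`,
`p·s > 1`, and `n_γ ≥ 0`, `m_γ ≥ 0`, `ℓ_γ > 0`, then:
`2√|Δ|·(ps) ≤ ℓ + √|Δ|`; `(ℓ + √|Δ|)(ps - 1) ≤ 2n(rs) ≤ (ℓ - √|Δ|)(ps)`;
`rs ≤ m/√|Δ|`; in particular `ps ≤ (m+1)/2`. -/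
theorem walls_case3b (m n ℓ p q r s : ℤ) (hm : 1 ≤ m) (hn : 1 ≤ n)
    (hl1 : 1 ≤ ℓ) (hlm : ℓ ≤ m) (hD : 4 * m * n < ℓ ^ 2)
    (hdet : p * s - q * r = 1) (hr : 0 < r) (hs : 0 < s) (hps : 1 < p * s)
    (hnγ : 0 ≤ s ^ 2 * n + q ^ 2 * m - s * q * ℓ)
    (hmγ : 0 ≤ r ^ 2 * n + p ^ 2 * m - p * r * ℓ)
    (hlγ : 0 < -2 * s * r * n - 2 * p * q * m + ℓ * (p * s + q * r)) :
    2 * Real.sqrt ((ℓ : ℝ) ^ 2 - 4 * m * n) * (p * s : ℤ)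
        ≤ (ℓ : ℝ) + Real.sqrt ((ℓ : ℝ) ^ 2 - 4 * m * n) ∧
    ((ℓ : ℝ) + Real.sqrt ((ℓ : ℝ) ^ 2 - 4 * m * n)) * ((p * s : ℤ) - 1)
        ≤ 2 * (n : ℝ) * (r * s : ℤ) ∧
    2 * (n : ℝ) * (r * s : ℤ)
        ≤ ((ℓ : ℝ) - Real.sqrt ((ℓ : ℝ) ^ 2 - 4 * m * n)) * (p * s : ℤ) ∧
    ((r * s : ℤ) : ℝ) ≤ (m : ℝ) / Real.sqrt ((ℓ : ℝ) ^ 2 - 4 * m * n) ∧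
    ((p * s : ℤ) : ℝ) ≤ ((m : ℝ) + 1) / 2 := by
  have hqr : 0 < q * r := by linarith
  have hq : 0 < q := pos_of_mul_pos_left hqr hr.le
  have hp : 0 < p := pos_of_mul_pos_left (by linarith : 0 < p * s) hs.le
  have hDZ : (1 : ℤ) ≤ ℓ ^ 2 - 4 * m * n := by linarith
  have hD1 : (1 : ℝ) ≤ (ℓ : ℝ) ^ 2 - 4 * m * n := by exact_mod_cast hDZ
  have hd1 : 1 ≤ Real.sqrt ((ℓ : ℝ) ^ 2 - 4 * m * n) := Real.one_le_sqrt.mpr hD1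
  have hd2 := Real.sq_sqrt (by linarith : (0 : ℝ) ≤ (ℓ : ℝ) ^ 2 - 4 * m * n)
  generalize Real.sqrt ((ℓ : ℝ) ^ 2 - 4 * m * n) = d at hd1 hd2 ⊢
  have hnγ' : (0 : ℝ) ≤ s ^ 2 * n + q ^ 2 * m - s * q * ℓ := by exact_mod_cast hnγ
  have hmγ' : (0 : ℝ) ≤ r ^ 2 * n + p ^ 2 * m - p * r * ℓ := by exact_mod_cast hmγ
  have hlγ' : (0 : ℝ) < -2 * s * r * n - 2 * p * q * m + ℓ * (p * s + q * r) := by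
    exact_mod_cast hlγ
  have hdet' : (p : ℝ) * s - q * r = 1 := by exact_mod_cast hdet
  have hn' : (1 : ℝ) ≤ n := by exact_mod_cast hn
  have hlm' : (ℓ : ℝ) ≤ m := by exact_mod_cast hlm
  have hl' : (1 : ℝ) ≤ ℓ := by exact_mod_cast hl1
  have hr' : (0 : ℝ) < r := by exact_mod_cast hr
  have hs' : (0 : ℝ) < s := by exact_mod_cast hs
  have hp' : (0 : ℝ) < p := by exact_mod_cast hp
  have hq' : (0 : ℝ) < q := by exact_mod_cast hq
  push_cast
  clear hnγ hmγ hlγ hdet hn hlm hl1 hr hs hp hq hqr hDZ hD hps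
  generalize (p : ℝ) = p, (q : ℝ) = q, (r : ℝ) = r, (s : ℝ) = s, (n : ℝ) = n,
    (m : ℝ) = m, (ℓ : ℝ) = l at *
  have hd0 : 0 < d := by linarith
  obtain ⟨a, ha⟩ : ∃ a, a = 2 * n * s - (l + d) * q := ⟨_, rfl⟩
  obtain ⟨a', ha'⟩ : ∃ a, a = 2 * n * s - (l - d) * q := ⟨_, rfl⟩
  obtain ⟨b, hb⟩ : ∃ a, a = 2 * n * r - (l + d) * p := ⟨_, rfl⟩
  obtain ⟨b', hb'⟩ : ∃ a, a = 2 * n * r - (l - d) * p := ⟨_, rfl⟩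
  have haa : 0 ≤ a * a' := by
    have : a * a' = 4 * n * (s ^ 2 * n + q ^ 2 * m - s * q * l) := by
      rw [ha, ha']; linear_combination (-q ^ 2) * hd2
    rw [this]; positivity
  have hbb : 0 ≤ b * b' := by
    have : b * b' = 4 * n * (r ^ 2 * n + p ^ 2 * m - p * r * l) := by
      rw [hb, hb']; linear_combination (-p ^ 2) * hd2
    rw [this]; positivity
  have hsum : a * b' + a' * b < 0 := by
    have : a * b' + a' * b
        = -(4 * n * (-2 * s * r * n - 2 * p * q * m + l * (p * s + q * r))) := by
      rw [ha, ha', hb, hb']; linear_combination (-2 * p * q) * hd2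
    rw [this]
    have : 0 < 4 * n * (-2 * s * r * n - 2 * p * q * m + l * (p * s + q * r)) := by
      positivity
    linarith
  have hdiff : 0 < a * b' - a' * b := by
    have : a * b' - a' * b = 4 * n * d := by
      rw [ha, ha', hb, hb']; linear_combination (4 * n * d) * hdet'
    rw [this]; positivity
  have h1 : a < a' := by rw [ha, ha']; nlinarith [mul_pos hd0 hq']
  have h2 : b < b' := by rw [hb, hb']; nlinarith [mul_pos hd0 hp']
  have hab : a' * b < 0 := by linarith
  have key : 0 ≤ a ∧ b' ≤ 0 := by
    rcases mul_neg_iff.mp hab with ⟨h3, h4⟩ | ⟨h3, h4⟩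
    · exact ⟨nonneg_of_mul_nonneg_left haa h3, by
        by_contra h
        push Not at h
        nlinarith [mul_neg_of_neg_of_pos h4 h]⟩
    · exfalso
      nlinarith [mul_pos (neg_pos.mpr h3) (sub_pos.mpr h2),
        mul_pos (sub_pos.mpr h1) (h4.trans h2)]
  obtain ⟨k1, k2⟩ := key
  have g1 : (l + d) * (p * s - 1) ≤ 2 * n * (r * s) := by
    have := mul_nonneg k1 hr'.le
    have e : p * s - 1 = q * r := by linarith
    rw [e]; rw [ha] at this; linarith
  have g2 : 2 * n * (r * s) ≤ (l - d) * (p * s) := by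
    have := mul_nonneg (neg_nonneg.mpr k2) hs'.le
    rw [hb'] at this; linarith
  have g0 : 2 * d * (p * s) ≤ l + d := by linarith
  have hlnn : 0 ≤ l - d := by
    have : 0 < (l - d) * (p * s) := lt_of_lt_of_le (by positivity) g2
    exact (pos_of_mul_pos_left this (by positivity)).le
  refine ⟨g0, g1, g2, ?_, ?_⟩
  · rw [le_div_iff₀ hd0]
    have h5 := mul_le_mul_of_nonneg_left g0 hlnn
    have h6 := mul_le_mul_of_nonneg_left g2 hd0.le
    have h7 : (4 * n) * (r * s * d) ≤ (4 * n) * m := by linarith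
    exact le_of_mul_le_mul_left h7 (by positivity)
  · have h8 : d * (2 * (p * s)) ≤ d * (m + 1) := by
      nlinarith [mul_nonneg (sub_nonneg.mpr hd1) (by linarith : 0 ≤ m)]
    have := le_of_mul_le_mul_left h8 hd0
    linarith
end

section
/- (Magnetic-BSM walls for n = −1.) Let m ≥ 1 and ℓ be integers with 0 ≤ ℓ ≤ m, and set n = −1, so |Δ| = ℓ² + 4m. Then an integer matrix γ = ((p, q), (r, s)) with determinant 1, r > 0 and s > 0 satisfies m_γ = −1, n_γ ≥ 0 and r·ℓ_γ > s if and only if p = 0, q = −1, r = 1 and ℓ < s ≤ (ℓ + √(ℓ² + 4m))/2 (inequality of real numbers); i.e. the contributing walls are exactly the matrices ((0, −1), (1, s)) with ℓ < s ≤ (ℓ + √(ℓ² + 4m))/2, and for such s one has s < m + 1. -/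
theorem sqrt_cond_iff (m ℓ s : ℤ) (hl0 : 0 ≤ ℓ) (hs : ℓ < s) :
    ((s : ℝ) ≤ ((ℓ : ℝ) + Real.sqrt ((ℓ : ℝ) ^ 2 + 4 * m)) / 2) ↔ s * (s - ℓ) ≤ m := by
  have hs' : (ℓ : ℝ) < s := by exact_mod_cast hs
  have hl' : (0 : ℝ) ≤ ℓ := by exact_mod_cast hl0
  have h1 : ((s : ℝ) ≤ ((ℓ : ℝ) + Real.sqrt ((ℓ : ℝ) ^ 2 + 4 * m)) / 2) ↔
      (2 * (s : ℝ) - ℓ ≤ Real.sqrt ((ℓ : ℝ) ^ 2 + 4 * m)) := by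
    constructor <;> intro h <;> linarith
  rw [h1, Real.le_sqrt' (by linarith)]
  have h2 : s * (s - ℓ) ≤ m ↔ (s : ℝ) * (s - ℓ) ≤ m := by exact_mod_cast Iff.rfl
  rw [h2]
  constructor <;> intro h <;> nlinarith

/-- Magnetic-BSM walls for `n = -1`: for `m ≥ 1`, `0 ≤ ℓ ≤ m` and `|Δ| = ℓ² + 4m`,
a matrix `γ = ((p,q),(r,s)) ∈ SL(2,ℤ)` with `r > 0`, `s > 0` satisfies
`m_γ = -1`, `n_γ ≥ 0` and `r·ℓ_γ > s` if and only if `p = 0`, `q = -1`, `r = 1` and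
`ℓ < s ≤ (ℓ + √(ℓ² + 4m))/2`; moreover any such `s` satisfies `s < m + 1`. -/
theorem magBSM_walls_n_eq_neg_one (m ℓ : ℤ) (hm : 1 ≤ m) (hl0 : 0 ≤ ℓ)
    (hlm : ℓ ≤ m) :
    (∀ p q r s : ℤ, p * s - q * r = 1 → 0 < r → 0 < s →
      ((r ^ 2 * (-1) + p ^ 2 * m - p * r * ℓ = -1 ∧
        0 ≤ s ^ 2 * (-1) + q ^ 2 * m - s * q * ℓ ∧
        s < r * (-2 * s * r * (-1) - 2 * p * q * m + ℓ * (p * s + q * r))) ↔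
       (p = 0 ∧ q = -1 ∧ r = 1 ∧ ℓ < s ∧
        (s : ℝ) ≤ ((ℓ : ℝ) + Real.sqrt ((ℓ : ℝ) ^ 2 + 4 * m)) / 2))) ∧
    (∀ s : ℤ, ℓ < s → (s : ℝ) ≤ ((ℓ : ℝ) + Real.sqrt ((ℓ : ℝ) ^ 2 + 4 * m)) / 2 →
      s < m + 1) := by
  refine ⟨?_, ?_⟩
  · intro p q r s hdet hr hs
    constructor
    · rintro ⟨h1, h2, h3⟩
      have e1 : r * (-2 * s * r * (-1) - 2 * p * q * m + ℓ * (p * s + q * r))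
          = 2 * s + 2 * p * m - ℓ * r := by
        linear_combination (-2 * s) * h1 + (2 * p * m - ℓ * r) * hdet
      have e2 : r ^ 2 * (s ^ 2 * (-1) + q ^ 2 * m - s * q * ℓ)
          = m - s * (s + 2 * p * m - ℓ * r) := by
        have hq : q * r = p * s - 1 := by linarith
        have : r ^ 2 * (s ^ 2 * (-1) + q ^ 2 * m - s * q * ℓ)
          = -s ^ 2 * r ^ 2 + (q * r) ^ 2 * m - s * r * (q * r) * ℓ := by ring
        rw [this, hq]
        linear_combination s ^ 2 * h1
      rw [e1] at h3
      have h4 : s * (s + 2 * p * m - ℓ * r) ≤ m := by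
        have := mul_nonneg (sq_nonneg r) h2
        linarith
      have ht : 0 < s + 2 * p * m - ℓ * r := by linarith
      have hsm : s ≤ m := by nlinarith
      have htm : s + 2 * p * m - ℓ * r ≤ m := by nlinarith
      have hlr : 0 ≤ ℓ * r := by positivity
      rcases lt_trichotomy p 0 with hp | hp | hp
      · exfalso
        nlinarith
      · subst hp
        have hr1 : r = 1 := by nlinarith
        subst hr1
        have hq : q = -1 := by linarith
        have hls : ℓ < s := by linarith
        refine ⟨rfl, hq, rfl, hls, (sqrt_cond_iff m ℓ s hl0 hls).2 ?_⟩
        linarith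
      · exfalso
        have h5 : p * (ℓ * r) ≤ p * (m * p) := by nlinarith
        have h6 : ℓ * r ≤ m * p := le_of_mul_le_mul_left h5 hp
        nlinarith
    · rintro ⟨rfl, rfl, rfl, hls, hh⟩
      have := (sqrt_cond_iff m ℓ s hl0 hls).1 hh
      refine ⟨by ring, by linarith, by linarith⟩
  · intro s hls hh
    have := (sqrt_cond_iff m ℓ s hl0 hls).1 hh
    nlinarith
end

section
/- (Magnetic-BSM walls for n = 0.) Let m ≥ 1 and ℓ ≥ 1 be integers with ℓ ≤ m, and set n = 0. Then an integer matrix γ = ((p, q), (r, s)) with determinant 1, r > 0 and s > 0 satisfies m_γ = −1, n_γ ≥ 0 and r·ℓ_γ > s if and only if ℓ divides m + 1 and γ = ((1, 0), ((m+1)/ℓ, 1)). -/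
/-- Magnetic-BSM walls for `n = 0`: for `m ≥ 1` and `1 ≤ ℓ ≤ m`, a matrix
`γ = ((p,q),(r,s)) ∈ SL(2,ℤ)` with `r > 0`, `s > 0` satisfies `m_γ = -1`, `n_γ ≥ 0`
and `r·ℓ_γ > s` if and only if `ℓ` divides `m + 1` and `γ = ((1,0),((m+1)/ℓ,1))`. -/
theorem magBSM_walls_n_eq_zero (m ℓ : ℤ) (hm : 1 ≤ m) (hl1 : 1 ≤ ℓ) (hlm : ℓ ≤ m)
    (p q r s : ℤ) (hdet : p * s - q * r = 1) (hr : 0 < r) (hs : 0 < s) :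
    (r ^ 2 * 0 + p ^ 2 * m - p * r * ℓ = -1 ∧
     0 ≤ s ^ 2 * 0 + q ^ 2 * m - s * q * ℓ ∧
     s < r * (-2 * s * r * 0 - 2 * p * q * m + ℓ * (p * s + q * r))) ↔
    (ℓ ∣ (m + 1) ∧ p = 1 ∧ q = 0 ∧ s = 1 ∧ r * ℓ = m + 1) := by
  constructor
  · rintro ⟨h1, h2, -⟩
    have hu : p * (r * ℓ - p * m) = 1 := by linarith
    have hrl : 0 < r * ℓ := mul_pos hr (by linarith)
    have hp : p = 1 := by
      rcases Int.eq_one_or_neg_one_of_mul_eq_one hu with h | h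
      · exact h
      · subst h
        exfalso
        linarith
    subst hp
    have hrm : r * ℓ = m + 1 := by linarith
    have hr2 : 2 ≤ r := by
      by_contra hc
      have hr1 : r = 1 := by omega
      subst hr1
      linarith
    have hq0 : 0 ≤ q := by
      by_contra hc
      have hq : q ≤ -1 := by omega
      nlinarith
    have hs' : s = 1 + q * r := by linarith
    have h3 : s ^ 2 * 0 + q ^ 2 * m - s * q * ℓ = -(q * ℓ + q * q) := by
      have hm' : m = r * ℓ - 1 := by linarith
      rw [hs', hm']
      ring
    have hq : q = 0 := by
      rw [h3] at h2
      nlinarith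
    subst hq
    exact ⟨⟨r, by linarith⟩, rfl, rfl, by linarith, hrm⟩
  · rintro ⟨-, rfl, rfl, rfl, h⟩
    refine ⟨by linarith, by linarith, by linarith⟩
end

section
/- (No dyonic metamorphosis for n = 0.) Let m and ℓ be integers with ℓ ≥ 1, and set n = 0. Then there is no integer matrix γ with determinant 1 such that m_γ = −1 and n_γ = −1. (Equivalently: by discriminant invariance such a γ would give ℓ_γ² = ℓ² + 4 with ℓ_γ an integer, which is impossible for ℓ ≥ 1.) -/
/-- No dyonic metamorphosis for `n = 0`: for charges `(n,ℓ,m) = (0,ℓ,m)` with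
`ℓ ≥ 1`, there is no `γ = ((p,q),(r,s)) ∈ SL(2,ℤ)` with `m_γ = -1` and `n_γ = -1`. -/
theorem no_dyonicBSM_n_eq_zero (m ℓ : ℤ) (hl : 1 ≤ ℓ) :
    ¬ ∃ p q r s : ℤ,
      p * s - q * r = 1 ∧
      r ^ 2 * 0 + p ^ 2 * m - p * r * ℓ = -1 ∧
      s ^ 2 * 0 + q ^ 2 * m - s * q * ℓ = -1 := by
  rintro ⟨p, q, r, s, hd, hm, hn⟩
  -- discriminant invariance
  have key : (-2 * p * q * m + ℓ * (p * s + q * r)) ^ 2 = ℓ ^ 2 + 4 := by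
    have h1 : (-2 * p * q * m + ℓ * (p * s + q * r)) ^ 2
        = ℓ ^ 2 * (p * s - q * r) ^ 2
          + 4 * ((r ^ 2 * 0 + p ^ 2 * m - p * r * ℓ)
            * (s ^ 2 * 0 + q ^ 2 * m - s * q * ℓ)) := by ring
    rw [h1, hd, hm, hn]; ring
  generalize -2 * p * q * m + ℓ * (p * s + q * r) = L at key
  rw [← sq_abs L] at key
  have hL : 0 ≤ |L| := abs_nonneg L
  generalize |L| = a at key hL
  have h1 : ℓ < a := by nlinarith
  have h2 : a < ℓ + 2 := by nlinarith
  obtain rfl : a = ℓ + 1 := by omega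
  have h3 : 2 * ℓ = 3 := by linarith
  omega
end

section
/- (The first dyonic-BSM wall.) Let m ≥ 1 and ℓ ≥ 0 be integers, set n = −1 and D = ℓ² + 4m, and suppose c is a positive integer with c² = D + 4. Then ℓ ≡ c (mod 2), so s₀ = (ℓ + c)/2 is an integer, and the matrix γ = ((0, −1), (1, s₀)) has determinant 1 and transformed charge invariants m_γ = −1, n_γ = −1, ℓ_γ = c. -/
/-- The first dyonic-BSM wall: for `m ≥ 1`, `ℓ ≥ 0`, `n = -1`, `D = ℓ² + 4m`, and
a positive integer `c` with `c² = D + 4`, one has `ℓ ≡ c (mod 2)`, so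
`s₀ = (ℓ + c)/2` is an integer, and `γ = ((0,-1),(1,s₀))` has determinant `1` and
transformed charge invariants `m_γ = -1`, `n_γ = -1`, `ℓ_γ = c`. -/
theorem first_dyonic_wall (m ℓ c : ℤ) (hm : 1 ≤ m) (hl : 0 ≤ ℓ) (hc : 0 < c)
    (hc2 : c ^ 2 = (ℓ ^ 2 + 4 * m) + 4) :
    ℓ % 2 = c % 2 ∧
    (∀ s₀ : ℤ, 2 * s₀ = ℓ + c →
      (0 : ℤ) * s₀ - (-1) * 1 = 1 ∧
      1 ^ 2 * (-1) + 0 ^ 2 * m - 0 * 1 * ℓ = -1 ∧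
      s₀ ^ 2 * (-1) + (-1) ^ 2 * m - s₀ * (-1) * ℓ = -1 ∧
      -2 * s₀ * 1 * (-1) - 2 * 0 * (-1) * m + ℓ * (0 * s₀ + (-1) * 1) = c) := by
  constructor
  · have h : (c ^ 2) % 2 = (ℓ ^ 2) % 2 := by rw [hc2]; omega
    rcases Int.emod_two_eq_zero_or_one ℓ with h1 | h1 <;>
      rcases Int.emod_two_eq_zero_or_one c with h2 | h2 <;>
      simp [pow_two, Int.mul_emod, h1, h2] at h ⊢
  · intro s h
    have hcs : c = 2 * s - ℓ := by linarith
    subst hcs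
    refine ⟨by ring, by ring, by nlinarith, by ring⟩
end

section
/- Let D be a positive integer such that D + 4 = c² for some positive integer c (this forces D to be a nonsquare). Then for every pair of positive integers (x, y) with x² − D·y² = 4 there exists a positive integer k such that (x + y·√D)/2 = ((c + √D)/2)^k as real numbers. In other words, all positive solutions of the Brahmagupta–Pell equation x² − D·y² = 4 are generated by powers of the fundamental solution (c, 1). -/
/-- All positive solutions of the Brahmagupta–Pell equation `x² - D·y² = 4` are
generated by powers of the fundamental solution `(c,1)`: if `D > 0` and `D + 4 = c²`
for a positive integer `c`, then for every pair of positive integers `(x,y)` with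
`x² - D·y² = 4` there is a positive integer `k` with
`(x + y·√D)/2 = ((c + √D)/2)^k` as real numbers. -/
theorem pell_solutions_generated (D c : ℤ) (hD : 0 < D) (hc : 0 < c)
    (hc2 : D + 4 = c ^ 2) :
    ∀ x y : ℤ, 0 < x → 0 < y → x ^ 2 - D * y ^ 2 = 4 →
      ∃ k : ℕ, 0 < k ∧
        ((x : ℝ) + (y : ℝ) * Real.sqrt (D : ℝ)) / 2
          = (((c : ℝ) + Real.sqrt (D : ℝ)) / 2) ^ k := by
  have hc3 : 3 ≤ c := by nlinarith
  have hDR : (0 : ℝ) ≤ (D : ℝ) := by exact_mod_cast hD.le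
  have hs : Real.sqrt (D : ℝ) * Real.sqrt (D : ℝ) = (D : ℝ) := Real.mul_self_sqrt hDR
  have hDc : (D : ℝ) + 4 = (c : ℝ) ^ 2 := by exact_mod_cast hc2
  have key : ∀ n : ℕ, ∀ x y : ℤ, y.toNat = n → 0 < x → 0 < y → x ^ 2 - D * y ^ 2 = 4 →
      ∃ k : ℕ, 0 < k ∧
        ((x : ℝ) + (y : ℝ) * Real.sqrt (D : ℝ)) / 2
          = (((c : ℝ) + Real.sqrt (D : ℝ)) / 2) ^ k := by
    intro n
    induction n using Nat.strong_induction_on with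
    | _ n ih =>
      intro x y hn hx hy h
      by_cases hy1 : y = 1
      · subst hy1
        have hxc : x = c := by nlinarith
        subst hxc
        exact ⟨1, one_pos, by simp⟩
      have hy2 : 2 ≤ y := by omega
      have e2 : Even (c * y - x) := by
        have h1 : Even (x ^ 2 - D * y ^ 2) := by rw [h]; decide
        have h2 : Even (D + 4 - c ^ 2) := by rw [hc2]; simp
        simp only [Int.even_sub, Int.even_add, Int.even_mul, Int.even_pow] at h1 h2 ⊢
        have : Even (4 : ℤ) := by decide
        tauto
      have e1 : Even (c * x - D * y) := by
        have h1 : Even (x ^ 2 - D * y ^ 2) := by rw [h]; decide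
        have h2 : Even (D + 4 - c ^ 2) := by rw [hc2]; simp
        simp only [Int.even_sub, Int.even_add, Int.even_mul, Int.even_pow] at h1 h2 ⊢
        have : Even (4 : ℤ) := by decide
        tauto
      obtain ⟨b, hb⟩ := e2
      obtain ⟨a, ha⟩ := e1
      have hbpos : x < c * y := by
        apply lt_of_pow_lt_pow_left₀ 2 (by positivity)
        have : (c * y) ^ 2 = x ^ 2 + 4 * y ^ 2 - 4 := by
          rw [mul_pow, ← hc2]; linarith
        nlinarith
      have hapos : D * y < c * x := by
        apply lt_of_pow_lt_pow_left₀ 2 (by positivity)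
        have : (c * x) ^ 2 = (D * y) ^ 2 + 4 * D + 4 * x ^ 2 := by
          rw [mul_pow, ← hc2]; linear_combination D * h
        nlinarith
      have hlt : (c - 2) * y < x := by
        apply lt_of_pow_lt_pow_left₀ 2 hx.le
        have : x ^ 2 = ((c - 2) * y) ^ 2 + 4 * (c - 2) * y ^ 2 + 4 := by
          linear_combination h + y ^ 2 * hc2
        have : 0 ≤ 4 * (c - 2) * y ^ 2 :=
          mul_nonneg (by linarith) (sq_nonneg y)
        linarith
      have hb0 : 0 < b := by linarith
      have ha0 : 0 < a := by linarith
      have hby : b < y := by linarith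
      have hab : a ^ 2 - D * b ^ 2 = 4 := by
        have : 4 * (a ^ 2 - D * b ^ 2) = 4 * 4 := by
          have h3 : 4 * (a ^ 2 - D * b ^ 2) = (c * x - D * y) ^ 2 - D * (c * y - x) ^ 2 := by
            rw [ha, hb]; ring
          rw [h3]
          linear_combination (c ^ 2 - D) * h - 4 * hc2
        linarith
      obtain ⟨k, hk, hk2⟩ := ih b.toNat (by omega) a b rfl ha0 hb0 hab
      refine ⟨k + 1, by omega, ?_⟩
      rw [pow_succ, ← hk2]
      have haR : (c : ℝ) * x - D * y = a + a := by exact_mod_cast ha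
      have hbR : (c : ℝ) * y - x = b + b := by exact_mod_cast hb
      have ha' : (a : ℝ) = (c * x - D * y) / 2 := by linarith
      have hb' : (b : ℝ) = (c * y - x) / 2 := by linarith
      rw [ha', hb']
      generalize Real.sqrt (D : ℝ) = s at *
      linear_combination (x / 8 + y * s / 8) * hDc - (c * y - x) / 8 * hs
  intro x y hx hy h
  exact key _ x y rfl hx hy h
end

section
/- (Generation of the dyonic metamorphosis orbit.) Let D > 0 and ℓ be real numbers and let c be a real number with c² = D + 4. For real numbers x, y define the 2×2 real matrix γ₊(x, y) = ((y, (y·c − x)/2), ((x − ℓ·y)/2, (x·(ℓ + c) − y·(D + ℓ·c))/4)). Then for all real x, y the matrix identity γ₊(x, y) · ((c, 1), (−1, 0)) = γ₊((c·x + D·y)/2, (x + c·y)/2) holds; i.e. right multiplication by M₁·S̃ = ((c, 1), (−1, 0)) implements on the wall matrices the Brahmagupta–Pell recursion x ↦ (c·x + D·y)/2, y ↦ (x + c·y)/2. -/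
/-- The wall matrix `γ₊(x,y)` associated to a solution `(x,y)` of the
Brahmagupta–Pell equation, for parameters `D`, `ℓ`, `c` with `c² = D + 4`. -/
noncomputable def gammaPlus (D ℓ c x y : ℝ) : Matrix (Fin 2) (Fin 2) ℝ :=
  !![y, (y * c - x) / 2;
     (x - ℓ * y) / 2, (x * (ℓ + c) - y * (D + ℓ * c)) / 4]

/-- Generation of the dyonic metamorphosis orbit: right multiplication of the wall
matrices `γ₊(x,y)` by `M₁·S̃ = ((c,1),(-1,0))` implements the Brahmagupta–Pell
recursion `x ↦ (c·x + D·y)/2`, `y ↦ (x + c·y)/2`. -/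
theorem gammaPlus_recursion (D ℓ c : ℝ) (hD : 0 < D) (hc2 : c ^ 2 = D + 4) :
    ∀ x y : ℝ,
      gammaPlus D ℓ c x y * !![c, 1; -1, 0]
        = gammaPlus D ℓ c ((c * x + D * y) / 2) ((x + c * y) / 2) := by
  intro x y
  obtain rfl : D = c ^ 2 - 4 := by linarith
  unfold gammaPlus
  ext i j
  fin_cases i <;> fin_cases j <;>
    simp [Matrix.mul_apply, Fin.sum_univ_two] <;> ring
end

section
/- (Dyonic-BSM walls from Brahmagupta–Pell solutions.) Let m ≥ 1 and ℓ ≥ 0 be integers, set n = −1 and D = ℓ² + 4m, and suppose c is a positive integer with c² = D + 4. Let x, y be integers with x² − D·y² = 4. Then x ≡ ℓ·y (mod 2), y·c − x is even, and x·(ℓ + c) − y·(D + ℓ·c) is divisible by 4; the matrix γ = ((y, (y·c − x)/2), ((x − ℓ·y)/2, (x·(ℓ + c) − y·(D + ℓ·c))/4)) has integer entries and determinant 1; and its transformed charge invariants with respect to (n, ℓ, m) = (−1, ℓ, m) are m_γ = −1, n_γ = −1, ℓ_γ = c. -/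
/-- Dyonic-BSM walls from Brahmagupta–Pell solutions: for `m ≥ 1`, `ℓ ≥ 0`,
`n = -1`, `D = ℓ² + 4m`, a positive integer `c` with `c² = D + 4`, and integers
`x, y` with `x² - D·y² = 4`: one has `x ≡ ℓ·y (mod 2)`, `y·c - x` even, and
`4 ∣ x·(ℓ+c) - y·(D + ℓ·c)`; the matrix
`γ = ((y, (y·c - x)/2), ((x - ℓ·y)/2, (x·(ℓ+c) - y·(D + ℓ·c))/4))` has integer
entries and determinant `1`, and its transformed charge invariants with respect to
`(n,ℓ,m) = (-1,ℓ,m)` are `m_γ = -1`, `n_γ = -1`, `ℓ_γ = c`. -/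
theorem dyonic_walls_from_pell (m ℓ c D : ℤ) (hm : 1 ≤ m) (hl : 0 ≤ ℓ)
    (hD : D = ℓ ^ 2 + 4 * m) (hc : 0 < c) (hc2 : c ^ 2 = D + 4)
    (x y : ℤ) (hxy : x ^ 2 - D * y ^ 2 = 4) :
    (2 ∣ x - ℓ * y) ∧ (2 ∣ y * c - x) ∧ (4 ∣ x * (ℓ + c) - y * (D + ℓ * c)) ∧
    (∀ p q r s : ℤ,
      p = y → 2 * q = y * c - x → 2 * r = x - ℓ * y →
      4 * s = x * (ℓ + c) - y * (D + ℓ * c) →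
      p * s - q * r = 1 ∧
      r ^ 2 * (-1) + p ^ 2 * m - p * r * ℓ = -1 ∧
      s ^ 2 * (-1) + q ^ 2 * m - s * q * ℓ = -1 ∧
      -2 * s * r * (-1) - 2 * p * q * m + ℓ * (p * s + q * r) = c) := by
  have par : ∀ a b t : ℤ, a ^ 2 - b ^ 2 = 4 * t → 2 ∣ a - b := by
    intro a b t h
    have h2 : Even (a ^ 2 - b ^ 2) := ⟨2 * t, by linarith⟩
    have h3 : Even (a - b) := by
      simpa [Int.even_sub, Int.even_pow] using h2
    exact h3.two_dvd
  obtain ⟨u, hu⟩ : (2 : ℤ) ∣ x - ℓ * y :=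
    par _ _ (1 + m * y ^ 2) (by subst hD; linear_combination hxy)
  obtain ⟨k, hk⟩ : (2 : ℤ) ∣ c - ℓ := par _ _ (m + 1) (by subst hD; linear_combination hc2)
  obtain rfl : x = ℓ * y + 2 * u := by linarith
  obtain rfl : c = ℓ + 2 * k := by linarith
  subst hD
  have hM : m = k ^ 2 + k * ℓ - 1 := by linarith
  have hE : u ^ 2 + u * ℓ * y - m * y ^ 2 = 1 := by linarith
  refine ⟨⟨u, by ring⟩, ⟨k * y - u, by ring⟩, ⟨u * (ℓ + k) - m * y, by ring⟩, ?_⟩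
  intro p q r s hp hq hr hs
  obtain rfl : q = k * y - u := by linarith
  obtain rfl : r = u := by linarith
  obtain rfl : s = r * (ℓ + k) - m * y := by linarith
  subst hp
  subst hM
  refine ⟨by linear_combination hE, by linear_combination -hE, ?_, ?_⟩
  · linear_combination -hE
  · linear_combination (ℓ + 2 * k) * hE
end
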